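/- arXiv:math/0703062 — 2 statements merged into one kernel-verified Lean document; each statement's English description precedes it below -/
import Mathlib

section
/- (Bohr-type inequality) If φ = Σ_{β∈F_n^+} c_β W_β ∈ F_n^∞(D_f), then for every λ = (λ_1,…,λ_n) ∈ ℂ^n with (3λ_1,…,3λ_n) ∈ D_f(ℂ) (i.e., Σ_{|α|≥1} a_α 9^{|α|}|λ_α|² ≤ 1), one has Σ_{β∈F_n^+} |c_β| |λ_β| ≤ ‖φ(W_1,…,W_n)‖. The inequality is strict unless φ is a scalar multiple of the identity. -/
open Filter Topology
open scoped ComplexConjugate ENNReal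

namespace NCDomain

/-- Words in the free monoid `F_n^+` on `n` generators. -/
abbrev Word (n : ℕ) := FreeMonoid (Fin n)

instance {n : ℕ} : DecidableEq (Word n) :=
  inferInstanceAs (DecidableEq (List (Fin n)))

/-- The length `|α|` of a word. -/
def wordLen {n : ℕ} (α : Word n) : ℕ := FreeMonoid.length α

/-- The coefficients `b_α`, defined by `b_{g_0} = 1` and, for `|α| ≥ 1`,
`b_α = Σ_{j=1}^{|α|} Σ_{γ_1⋯γ_j = α, |γ_i| ≥ 1} a_{γ_1}⋯a_{γ_j}`, the sum running over
all ordered factorizations of `α` into nonempty words. -/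
noncomputable def bCoeff {n : ℕ} (a : Word n → ℝ) (α : Word n) : ℝ :=
  if α = 1 then 1
  else ∑' L : {L : List (Word n) // L.prod = α ∧ ∀ w ∈ L, w ≠ 1}, (L.1.map a).prod

/-- `f = Σ_{|α|≥1} a_α X_α` is a positive regular free holomorphic function:
`a_{g_0} = 0`, `a_α ≥ 0`, `a_{g_i} > 0`, and
`limsup_{k→∞} (Σ_{|α|=k} |a_α|²)^{1/(2k)} < ∞`. -/
def PosRegular {n : ℕ} (a : Word n → ℝ) : Prop :=
  a 1 = 0 ∧ (∀ α, 0 ≤ a α) ∧ (∀ i : Fin n, 0 < a (FreeMonoid.of i)) ∧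
    ∃ C : ℝ, ∀ᶠ k in atTop,
      (∑' α : {β : Word n // wordLen β = k}, (a α.1) ^ 2) ≤ C ^ (2 * k)

/-- For a tuple `T` of operators and a word `α = g_{i_1}⋯g_{i_k}`,
the product `T_α = T_{i_1}⋯T_{i_k}` (and `T_{g_0} = I`). -/
noncomputable def opWord {n : ℕ} {H : Type*} [NormedAddCommGroup H] [NormedSpace ℂ H]
    (T : Fin n → H →L[ℂ] H) (α : Word n) : H →L[ℂ] H :=
  ((FreeMonoid.toList α).map T).prod

/-- The full Fock space `F²(H_n)`, realized as `ℓ²` over the free monoid. -/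
abbrev Fock (n : ℕ) : Type := lp (fun _ : Word n => ℂ) 2

/-- The canonical orthonormal basis vector `e_α` of the Fock space. -/
noncomputable def fockBasis {n : ℕ} (α : Word n) : Fock n := lp.single 2 α (1 : ℂ)

/-- `W` is the tuple of weighted left creation operators associated with `f = Σ a_α X_α`:
`W_i e_α = √(b_α / b_{g_i α}) e_{g_i α}`. -/
def IsWeightedShift {n : ℕ} (a : Word n → ℝ) (W : Fin n → Fock n →L[ℂ] Fock n) : Prop :=
  ∀ (i : Fin n) (α : Word n),
    W i (fockBasis α) =
      (Real.sqrt (bCoeff a α / bCoeff a (FreeMonoid.of i * α)) : ℂ) •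
        fockBasis (FreeMonoid.of i * α)

/-- The scalar `λ_α = λ_{i_1}⋯λ_{i_k}` for a word `α = g_{i_1}⋯g_{i_k}`. -/
noncomputable def lamWord {n : ℕ} (lam : Fin n → ℂ) (α : Word n) : ℂ :=
  ((FreeMonoid.toList α).map lam).prod

lemma wordLen_mul {n : ℕ} (x y : Word n) : wordLen (x * y) = wordLen x + wordLen y :=
  FreeMonoid.length_mul x y

lemma wordLen_eq_zero {n : ℕ} {x : Word n} : wordLen x = 0 ↔ x = 1 :=
  FreeMonoid.length_eq_zero

lemma wordLen_one {n : ℕ} : wordLen (1 : Word n) = 0 := wordLen_eq_zero.2 rfl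

lemma finite_len_le (n k : ℕ) : {w : Word n | wordLen w ≤ k}.Finite :=
  List.finite_length_le (Fin n) k

lemma finite_len_eq (n k : ℕ) : {w : Word n | wordLen w = k}.Finite :=
  (finite_len_le n k).subset (fun _ h => le_of_eq h)

noncomputable def lvl (n k : ℕ) : Finset (Word n) := (finite_len_eq n k).toFinset

lemma mem_lvl {n k : ℕ} {w : Word n} : w ∈ lvl n k ↔ wordLen w = k := by
  simp [lvl]

lemma wordLen_prod {n : ℕ} (L : List (Word n)) : wordLen L.prod = (L.map wordLen).sum := by
  induction L with
  | nil => simp [wordLen_one]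
  | cons w L ih => simp [wordLen_mul, ih]

lemma finite_fact_le (n k : ℕ) :
    {L : List (Word n) | wordLen L.prod ≤ k ∧ ∀ w ∈ L, w ≠ 1}.Finite := by
  induction k with
  | zero =>
    refine (Set.finite_singleton []).subset ?_
    rintro L ⟨h1, h2⟩
    cases L with
    | nil => simp
    | cons w L =>
      exfalso
      have := h2 w (by simp)
      rw [List.prod_cons, wordLen_mul] at h1
      exact this (wordLen_eq_zero.1 (by omega))
  | succ k ih =>
    refine ((Set.finite_singleton []).union
      (Set.Finite.image2 List.cons (finite_len_le n (k+1)) ih)).subset ?_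
    rintro L ⟨h1, h2⟩
    cases L with
    | nil => simp
    | cons w L =>
      right
      have hw := h2 w (by simp)
      have hw' : wordLen w ≠ 0 := fun h => hw (wordLen_eq_zero.1 h)
      rw [List.prod_cons, wordLen_mul] at h1
      refine ⟨w, by simp; omega, L, ⟨by omega, fun v hv => h2 v (by simp [hv])⟩, rfl⟩

lemma finite_fact {n : ℕ} (α : Word n) :
    {L : List (Word n) | L.prod = α ∧ ∀ w ∈ L, w ≠ 1}.Finite :=
  (finite_fact_le n (wordLen α)).subset (by
    rintro L ⟨h1, h2⟩
    exact ⟨by rw [h1], h2⟩)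

noncomputable def fact {n : ℕ} (α : Word n) : Finset (List (Word n)) := (finite_fact α).toFinset

lemma mem_fact {n : ℕ} {α : Word n} {L : List (Word n)} :
    L ∈ fact α ↔ L.prod = α ∧ ∀ w ∈ L, w ≠ 1 := by
  simp [fact]

lemma bCoeff_eq {n : ℕ} (a : Word n → ℝ) {α : Word n} (h : α ≠ 1) :
    bCoeff a α = ∑ L ∈ fact α, (L.map a).prod := by
  rw [bCoeff, if_neg h]
  rw [← Finset.tsum_subtype]
  exact (Equiv.tsum_eq (Equiv.subtypeEquivRight (fun L => (mem_fact (α := α) (L := L)).symm))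
    (fun L : {L // L ∈ fact α} => (L.1.map a).prod))

lemma bCoeff_pos {n : ℕ} {a : Word n → ℝ} (ha : ∀ α, 0 ≤ a α)
    (ha1 : ∀ i : Fin n, 0 < a (FreeMonoid.of i)) (α : Word n) : 0 < bCoeff a α := by
  by_cases h : α = 1
  · simp [bCoeff, h]
  rw [bCoeff_eq a h]
  have hnn : ∀ L ∈ fact α, 0 ≤ (L.map a).prod := by
    intro L _
    apply List.prod_nonneg
    intro x hx
    obtain ⟨w, _, rfl⟩ := List.mem_map.1 hx
    exact ha w
  refine Finset.sum_pos' hnn ⟨(FreeMonoid.toList α).map FreeMonoid.of, ?_, ?_⟩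
  · rw [mem_fact]
    refine ⟨?_, ?_⟩
    · induction α using FreeMonoid.inductionOn' with
      | one => rfl
      | of_mul b l ih =>
        rw [FreeMonoid.toList_of_mul, List.map_cons, List.prod_cons]
        by_cases hl : l = 1
        · subst hl; rfl
        · rw [ih hl]
          intro L hL
          apply List.prod_nonneg
          intro x hx
          obtain ⟨w, _, rfl⟩ := List.mem_map.1 hx
          exact ha w
    · intro w hw
      obtain ⟨i, _, rfl⟩ := List.mem_map.1 hw
      exact FreeMonoid.of_ne_one i
  · apply List.prod_pos
    intro x hx
    obtain ⟨w, hw, rfl⟩ := List.mem_map.1 hx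
    obtain ⟨i, _, rfl⟩ := List.mem_map.1 hw
    exact ha1 i

lemma sum_fact_le {n : ℕ} (x : Word n → ℝ) (hx : ∀ w, 0 ≤ x w)
    (hx1 : ∀ t : Finset (Word n), (∀ w ∈ t, w ≠ 1) → ∑ w ∈ t, x w ≤ 1) (k : ℕ) :
    ∀ s : Finset (List (Word n)), (∀ L ∈ s, wordLen L.prod = k ∧ ∀ w ∈ L, w ≠ 1) →
      ∑ L ∈ s, (L.map x).prod ≤ 1 := by
  induction k using Nat.strong_induction_on with
  | _ k ih =>
  intro s hs
  have hnn : ∀ L : List (Word n), 0 ≤ (L.map x).prod := by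
    intro L
    apply List.prod_nonneg
    intro y hy
    obtain ⟨w, _, rfl⟩ := List.mem_map.1 hy
    exact hx w
  by_cases hk : k = 0
  · have hsub : s ⊆ {[]} := by
      intro L hL
      obtain ⟨h1, h2⟩ := hs L hL
      cases L with
      | nil => simp
      | cons w L =>
        exfalso
        have := h2 w (by simp)
        rw [List.prod_cons, wordLen_mul] at h1
        exact this (wordLen_eq_zero.1 (by omega))
    calc ∑ L ∈ s, (L.map x).prod ≤ ∑ L ∈ {[]}, (L.map x).prod :=
          Finset.sum_le_sum_of_subset_of_nonneg hsub (fun L _ _ => hnn L)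
      _ ≤ 1 := by simp
  · have hne : ∀ L ∈ s, ∃ w l, L = w :: l := by
      intro L hL
      cases L with
      | nil =>
        have := (hs _ hL).1
        simp [wordLen_one] at this
        omega
      | cons w l => exact ⟨w, l, rfl⟩
    rw [← Finset.sum_fiberwise_of_maps_to (g := fun L => L.headD 1) (t := s.image (fun L => L.headD 1))
      (fun L hL => Finset.mem_image_of_mem _ hL)]
    have hh : ∀ w ∈ s.image (fun L => L.headD 1), w ≠ 1 := by
      intro w hw
      obtain ⟨L, hL, rfl⟩ := Finset.mem_image.1 hw
      obtain ⟨w, l, rfl⟩ := hne L hL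
      exact (hs _ hL).2 w (by simp)
    refine le_trans (Finset.sum_le_sum (g := x) ?_) (hx1 _ hh)
    intro w hw
    have hw1 := hh w hw
    have hw0 : wordLen w ≠ 0 := fun h => hw1 (wordLen_eq_zero.1 h)
    have hform : ∀ L ∈ s.filter (fun L => L.headD 1 = w), L = w :: L.tail := by
      intro L hL
      rw [Finset.mem_filter] at hL
      obtain ⟨v, l, rfl⟩ := hne L hL.1
      have := hL.2
      simp at this
      simp [this]
    have hinj : Set.InjOn List.tail (↑(s.filter (fun L => L.headD 1 = w)) : Set (List (Word n))) := by
      intro L hL L' hL' h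
      rw [hform L hL, hform L' hL', h]
    calc ∑ L ∈ s.filter (fun L => L.headD 1 = w), (L.map x).prod
        = ∑ L ∈ s.filter (fun L => L.headD 1 = w), x w * (L.tail.map x).prod := by
          refine Finset.sum_congr rfl (fun L hL => ?_)
          conv_lhs => rw [hform L hL]
          simp
      _ = x w * ∑ l ∈ (s.filter (fun L => L.headD 1 = w)).image List.tail, (l.map x).prod := by
          rw [← Finset.mul_sum, Finset.sum_image hinj]
      _ ≤ x w * 1 := by
          refine mul_le_mul_of_nonneg_left ?_ (hx w)
          by_cases hwk : wordLen w ≤ k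
          · refine ih (k - wordLen w) (by omega) _ ?_
            intro l hl
            obtain ⟨L, hL, rfl⟩ := Finset.mem_image.1 hl
            have h1 := hform L hL
            have h2 := hs L (Finset.mem_filter.1 hL).1
            rw [h1, List.prod_cons, wordLen_mul] at h2
            exact ⟨by omega, fun v hv => h2.2 v (by simp [hv])⟩
          · exfalso
            obtain ⟨L, hL, hLw⟩ := Finset.mem_image.1 hw
            have hL' : L ∈ s.filter (fun L => L.headD 1 = w) := Finset.mem_filter.2 ⟨hL, hLw⟩
            have h1 := hform L hL'
            have h2 := (hs L hL).1
            rw [h1, List.prod_cons, wordLen_mul] at h2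
            omega
      _ = x w := mul_one _

lemma lamWord_one {n : ℕ} (m : Fin n → ℂ) : lamWord m 1 = 1 := by
  simp [lamWord]

lemma lamWord_mul {n : ℕ} (m : Fin n → ℂ) (u v : Word n) :
    lamWord m (u * v) = lamWord m u * lamWord m v := by
  simp [lamWord, FreeMonoid.toList_mul]

lemma lamWord_three {n : ℕ} (m : Fin n → ℂ) (u : Word n) :
    ‖lamWord (fun i => 3 * m i) u‖ = 3 ^ wordLen u * ‖lamWord m u‖ := by
  induction u using FreeMonoid.inductionOn' with
  | one => simp [lamWord_one, wordLen_one]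
  | of_mul b l ih =>
    have h1 : wordLen (FreeMonoid.of b) = 1 := rfl
    rw [lamWord_mul, lamWord_mul, norm_mul, norm_mul, ih, wordLen_mul, h1]
    simp [lamWord]
    ring

lemma prod_weight {n : ℕ} (a : Word n → ℝ) (m : Fin n → ℂ) (L : List (Word n)) :
    (L.map (fun w => a w * ‖lamWord m w‖ ^ 2)).prod
      = (L.map a).prod * ‖lamWord m L.prod‖ ^ 2 := by
  induction L with
  | nil => simp [lamWord_one]
  | cons w L ih =>
    simp only [List.map_cons, List.prod_cons, ih, lamWord_mul, norm_mul]
    ring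

lemma level_b {n : ℕ} {a : Word n → ℝ} (ha : ∀ α, 0 ≤ a α) (m : Fin n → ℂ)
    (hsum : Summable (fun α : {γ : Word n // γ ≠ 1} => a α.1 * ‖lamWord m α.1‖ ^ 2))
    (hmem : (∑' α : {γ : Word n // γ ≠ 1}, a α.1 * ‖lamWord m α.1‖ ^ 2) ≤ 1)
    {k : ℕ} (hk : k ≠ 0) :
    ∑ α ∈ lvl n k, bCoeff a α * ‖lamWord m α‖ ^ 2 ≤ 1 := by
  have hx : ∀ w, 0 ≤ a w * ‖lamWord m w‖ ^ 2 := fun w => mul_nonneg (ha w) (by positivity)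
  have hx1 : ∀ t : Finset (Word n), (∀ w ∈ t, w ≠ 1) →
      ∑ w ∈ t, a w * ‖lamWord m w‖ ^ 2 ≤ 1 := by
    intro t ht
    refine le_trans ?_ hmem
    rw [← Finset.sum_subtype_of_mem (p := fun γ => γ ≠ 1) _ ht]
    exact hsum.sum_le_tsum _ (fun w _ => hx _)
  calc ∑ α ∈ lvl n k, bCoeff a α * ‖lamWord m α‖ ^ 2
      = ∑ α ∈ lvl n k, ∑ L ∈ fact α, (L.map (fun w => a w * ‖lamWord m w‖ ^ 2)).prod := by
        refine Finset.sum_congr rfl (fun α hα => ?_)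
        have h1 : α ≠ 1 := by
          rintro rfl
          rw [mem_lvl, wordLen_one] at hα
          omega
        rw [bCoeff_eq a h1, Finset.sum_mul]
        refine Finset.sum_congr rfl (fun L hL => ?_)
        rw [prod_weight, (mem_fact.1 hL).1]
    _ = ∑ L ∈ (lvl n k).biUnion fact, (L.map (fun w => a w * ‖lamWord m w‖ ^ 2)).prod := by
        rw [Finset.sum_biUnion]
        intro α _ β _ hne
        rw [Function.onFun, Finset.disjoint_left]
        intro L h1 h2
        exact hne ((mem_fact.1 h1).1.symm.trans (mem_fact.1 h2).1)
    _ ≤ 1 := by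
        refine sum_fact_le _ hx hx1 k _ ?_
        intro L hL
        obtain ⟨α, hα, hL⟩ := Finset.mem_biUnion.1 hL
        rw [mem_fact] at hL
        exact ⟨by rw [hL.1]; exact mem_lvl.1 hα, hL.2⟩

lemma opWord_basis {n : ℕ} {a : Word n → ℝ} (hb : ∀ α, 0 < bCoeff a α)
    {W : Fin n → Fock n →L[ℂ] Fock n} (hW : IsWeightedShift a W) (β γ : Word n) :
    opWord W β (fockBasis γ) =
      (Real.sqrt (bCoeff a γ / bCoeff a (β * γ)) : ℂ) • fockBasis (β * γ) := by
  induction β using FreeMonoid.inductionOn' with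
  | one =>
    have h := (hb γ).ne'
    simp [opWord, h]
  | of_mul i l ih =>
    have h : opWord W (FreeMonoid.of i * l) = W i * opWord W l := by
      simp [opWord]
    rw [h, mul_apply_eq_comp, ih, map_smul, hW i, smul_smul, mul_assoc]
    congr 1
    rw [← Complex.ofReal_mul, ← Real.sqrt_mul (div_nonneg (hb _).le (hb _).le)]
    have := (hb (l * γ)).ne'
    congr 2
    field_simp

lemma fockBasis_apply {n : ℕ} (γ δ : Word n) :
    (fockBasis γ : Fock n) δ = if δ = γ then 1 else 0 := by
  rw [fockBasis, lp.single_apply]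
  by_cases h : δ = γ
  · subst h; simp
  · simp [h]

section
variable {n : ℕ} {a : Word n → ℝ} {W : Fin n → Fock n →L[ℂ] Fock n}
  {c : Word n → ℂ} {φ : Fock n →L[ℂ] Fock n}

lemma phi_coord (hb : ∀ α, 0 < bCoeff a α) (hW : IsWeightedShift a W)
    (hφ : ∀ γ : Word n,
      HasSum (fun β : Word n => c β • opWord W β (fockBasis γ)) (φ (fockBasis γ)))
    (γ δ : Word n) :
    HasSum (fun β : Word n => c β * ((Real.sqrt (bCoeff a γ / bCoeff a (β * γ)) : ℂ) *
      if δ = β * γ then 1 else 0)) ((φ (fockBasis γ) : Fock n) δ) := by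
  have h := (hφ γ).mapL (lp.evalCLM ℂ (fun _ : Word n => ℂ) 2 δ)
  have e : (fun β : Word n => c β * ((Real.sqrt (bCoeff a γ / bCoeff a (β * γ)) : ℂ) *
      if δ = β * γ then 1 else 0)) = fun β : Word n =>
      (lp.evalCLM ℂ (fun _ : Word n => ℂ) 2 δ) (c β • opWord W β (fockBasis γ)) := by
    funext β
    rw [opWord_basis hb hW, map_smul, map_smul, ← fockBasis_apply]
    rfl
  rw [e]
  exact h

lemma phi_one (hb : ∀ α, 0 < bCoeff a α) (hW : IsWeightedShift a W)
    (hφ : ∀ γ : Word n,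
      HasSum (fun β : Word n => c β • opWord W β (fockBasis γ)) (φ (fockBasis γ)))
    (δ : Word n) :
    (φ (fockBasis 1) : Fock n) δ = c δ * (Real.sqrt (1 / bCoeff a δ) : ℂ) := by
  refine (phi_coord hb hW hφ 1 δ).unique ?_
  have h1 : bCoeff a (1 : Word n) = 1 := by simp [bCoeff]
  convert hasSum_single δ ?_ using 1
  · simp [h1]
  · intro β hβ
    simp [hβ.symm]

lemma phi_same (hb : ∀ α, 0 < bCoeff a α) (hW : IsWeightedShift a W)
    (hφ : ∀ γ : Word n,
      HasSum (fun β : Word n => c β • opWord W β (fockBasis γ)) (φ (fockBasis γ)))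
    (γ δ : Word n) (hl : wordLen δ ≤ wordLen γ) :
    (φ (fockBasis γ) : Fock n) δ = c 1 * if δ = γ then 1 else 0 := by
  refine (phi_coord hb hW hφ γ δ).unique ?_
  have h1 := (hb γ).ne'
  convert hasSum_single (1 : Word n) ?_ using 1
  · simp [h1]
  · intro β hβ
    have h2 : wordLen β ≠ 0 := fun h => hβ (wordLen_eq_zero.1 h)
    have : δ ≠ β * γ := by
      rintro rfl
      rw [wordLen_mul] at hl
      omega
    simp [this]

lemma fock_sum_le (x : Fock n) (s : Finset (Word n)) : ∑ δ ∈ s, ‖x δ‖ ^ 2 ≤ ‖x‖ ^ 2 := by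
  have := lp.sum_rpow_le_norm_rpow (p := 2) (by norm_num) x s
  simpa using this

lemma fock_norm_sq (s : Finset (Word n)) (d : Word n → ℂ) :
    ‖∑ δ ∈ s, d δ • (fockBasis δ : Fock n)‖ ^ 2 = ∑ δ ∈ s, ‖d δ‖ ^ 2 := by
  have := lp.norm_sum_single (p := 2) (E := fun _ : Word n => ℂ) (by norm_num) d s
  have h2 : ∀ δ, d δ • (fockBasis δ : Fock n) = lp.single 2 δ (d δ) := by
    intro δ
    rw [fockBasis, ← lp.single_smul]
    simp
  simp_rw [h2]
  simpa using this

lemma level_quad (hb : ∀ α, 0 < bCoeff a α) (hW : IsWeightedShift a W)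
    (hφ : ∀ γ : Word n,
      HasSum (fun β : Word n => c β • opWord W β (fockBasis γ)) (φ (fockBasis γ)))
    {k : ℕ} (hk : k ≠ 0) (s t : ℂ) :
    ‖s‖ ^ 2 * ‖c 1‖ ^ 2 + ‖s + t * c 1‖ ^ 2 * ∑ β ∈ lvl n k, ‖c β‖ ^ 2 / bCoeff a β
      ≤ ‖φ‖ ^ 2 * (‖s‖ ^ 2 + ‖t‖ ^ 2 * ∑ β ∈ lvl n k, ‖c β‖ ^ 2 / bCoeff a β) := by
  have hd : ∀ β, ‖c β * (Real.sqrt (1 / bCoeff a β) : ℂ)‖ ^ 2 = ‖c β‖ ^ 2 / bCoeff a β := by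
    intro β
    rw [norm_mul, Complex.norm_real, mul_pow, Real.norm_eq_abs, sq_abs,
      Real.sq_sqrt (div_nonneg zero_le_one (hb β).le)]
    ring
  have h1n : (1 : Word n) ∉ lvl n k := by
    rw [mem_lvl, wordLen_one]; omega
  have hb1 : bCoeff a (1 : Word n) = 1 := by simp [bCoeff]
  set d : Word n → ℂ := fun β => c β * (Real.sqrt (1 / bCoeff a β) : ℂ) with hddef
  let e : Word n → ℂ := fun β => if β = 1 then s else t * d β
  let x : Fock n := ∑ β ∈ insert 1 (lvl n k), e β • (fockBasis β : Fock n)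
  have hx : ‖x‖ ^ 2 = ‖s‖ ^ 2 + ‖t‖ ^ 2 * ∑ β ∈ lvl n k, ‖c β‖ ^ 2 / bCoeff a β := by
    rw [fock_norm_sq, Finset.sum_insert h1n, Finset.mul_sum]
    congr 1
    refine Finset.sum_congr rfl (fun β hβ => ?_)
    have : β ≠ 1 := fun h => h1n (h ▸ hβ)
    simp only [e, if_neg this, norm_mul, mul_pow]
    rw [← hd β]
  have hco : ∀ δ, (φ x : Fock n) δ = s * (φ (fockBasis 1) : Fock n) δ +
      ∑ β ∈ lvl n k, t * d β * (φ (fockBasis β) : Fock n) δ := by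
    intro δ
    have h0 : φ x = s • φ (fockBasis 1) + ∑ β ∈ lvl n k, (t * d β) • φ (fockBasis β) := by
      simp only [x]
      rw [Finset.sum_insert h1n, map_add, map_sum, map_smul]
      congr 1
      refine Finset.sum_congr rfl (fun β hβ => ?_)
      have : β ≠ 1 := fun h => h1n (h ▸ hβ)
      simp only [e, if_neg this, map_smul]
    generalize φ x = y at h0 ⊢
    have h1 := congrArg (lp.evalCLM ℂ (fun _ : Word n => ℂ) 2 δ) h0
    rw [map_add, map_sum, map_smul] at h1
    simp only [map_smul] at h1
    exact h1
  have hco1 : (φ x : Fock n) 1 = s * c 1 := by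
    rw [hco, Finset.sum_eq_zero, phi_one hb hW hφ]
    · simp [hb1]
    · intro β hβ
      have : (1 : Word n) ≠ β := fun h => h1n (h ▸ hβ)
      rw [phi_same hb hW hφ β 1 (by rw [wordLen_one]; omega)]
      simp [this]
  have hcok : ∀ δ ∈ lvl n k, (φ x : Fock n) δ = (s + t * c 1) * d δ := by
    intro δ hδ
    rw [hco, phi_one hb hW hφ, Finset.sum_eq_single δ]
    · rw [phi_same hb hW hφ δ δ le_rfl]
      simp only [hddef, if_true]
      ring
    · intro β hβ hne
      rw [phi_same hb hW hφ β δ (by rw [mem_lvl.1 hβ, mem_lvl.1 hδ])]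
      simp [hne.symm]
    · exact fun h => absurd hδ h
  have h1 := fock_sum_le (φ x) (insert 1 (lvl n k))
  rw [Finset.sum_insert h1n, hco1] at h1
  have h2 : ∑ δ ∈ lvl n k, ‖(φ x : Fock n) δ‖ ^ 2 =
      ‖s + t * c 1‖ ^ 2 * ∑ β ∈ lvl n k, ‖c β‖ ^ 2 / bCoeff a β := by
    rw [Finset.mul_sum]
    refine Finset.sum_congr rfl (fun β hβ => ?_)
    rw [hcok β hβ, norm_mul, mul_pow, ← hd β]
  rw [h2, norm_mul, mul_pow] at h1
  refine h1.trans ?_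
  rw [← hx, ← mul_pow]
  exact pow_le_pow_left₀ (norm_nonneg _) (φ.le_opNorm x) 2

lemma c1_le (hb : ∀ α, 0 < bCoeff a α) (hW : IsWeightedShift a W)
    (hφ : ∀ γ : Word n,
      HasSum (fun β : Word n => c β • opWord W β (fockBasis γ)) (φ (fockBasis γ))) :
    ‖c 1‖ ≤ ‖φ‖ := by
  have h := level_quad hb hW hφ one_ne_zero 1 0
  have hP : 0 ≤ ∑ β ∈ lvl n 1, ‖c β‖ ^ 2 / bCoeff a β :=
    Finset.sum_nonneg (fun β _ => div_nonneg (by positivity) (hb β).le)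
  simp at h
  exact le_of_sq_le_sq (by linarith) (norm_nonneg _)

lemma level_sqrt (hb : ∀ α, 0 < bCoeff a α) (hW : IsWeightedShift a W)
    (hφ : ∀ γ : Word n,
      HasSum (fun β : Word n => c β • opWord W β (fockBasis γ)) (φ (fockBasis γ)))
    {k : ℕ} (hk : k ≠ 0) :
    Real.sqrt (∑ β ∈ lvl n k, ‖c β‖ ^ 2 / bCoeff a β) ≤ (‖φ‖ ^ 2 - ‖c 1‖ ^ 2) / ‖φ‖ := by
  have hP : 0 ≤ ∑ β ∈ lvl n k, ‖c β‖ ^ 2 / bCoeff a β :=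
    Finset.sum_nonneg (fun β _ => div_nonneg (by positivity) (hb β).le)
  have h0 := level_quad hb hW hφ hk 1 0
  have h1 := level_quad hb hW hφ hk ((‖φ‖ ^ 2 - ‖c 1‖ ^ 2 : ℝ) : ℂ) (conj (c 1))
  have hc := c1_le hb hW hφ
  have hM := norm_nonneg φ
  have e1 : ((‖φ‖ ^ 2 - ‖c 1‖ ^ 2 : ℝ) : ℂ) + conj (c 1) * c 1 = ((‖φ‖ ^ 2 : ℝ) : ℂ) := by
    rw [mul_comm, Complex.mul_conj, Complex.normSq_eq_norm_sq]
    push_cast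
    ring
  rw [e1, Complex.norm_real, Complex.norm_real, RCLike.norm_conj, Real.norm_eq_abs,
    Real.norm_eq_abs, sq_abs, sq_abs] at h1
  generalize (∑ β ∈ lvl n k, ‖c β‖ ^ 2 / bCoeff a β) = P at *
  simp at h0
  generalize ‖φ‖ = M at *
  have hc0 := norm_nonneg (c 1)
  generalize ‖c 1‖ = C at *
  rcases hc.eq_or_lt with h | h
  · subst h
    have : P = 0 := by linarith
    simp [this]
  · have hMp : 0 < M := by linarith
    have hD : 0 < M ^ 2 - C ^ 2 := by nlinarith
    rw [le_div_iff₀ hMp]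
    have h3 : (M ^ 2 - C ^ 2) * (P * M ^ 2) ≤ (M ^ 2 - C ^ 2) * (M ^ 2 - C ^ 2) ^ 2 := by
      nlinarith
    have h4 := le_of_mul_le_mul_left h3 hD
    refine le_of_sq_le_sq ?_ hD.le
    rw [mul_pow, Real.sq_sqrt hP]
    exact h4

lemma level_sum (hb : ∀ α, 0 < bCoeff a α) (ha : ∀ α, 0 ≤ a α) (hW : IsWeightedShift a W)
    (hφ : ∀ γ : Word n,
      HasSum (fun β : Word n => c β • opWord W β (fockBasis γ)) (φ (fockBasis γ)))
    (lam : Fin n → ℂ)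
    (hsum : Summable (fun α : {γ : Word n // γ ≠ 1} =>
      a α.1 * ‖lamWord (fun i => 3 * lam i) α.1‖ ^ 2))
    (hmem : (∑' α : {γ : Word n // γ ≠ 1},
      a α.1 * ‖lamWord (fun i => 3 * lam i) α.1‖ ^ 2) ≤ 1)
    {k : ℕ} (hk : k ≠ 0) :
    ∑ β ∈ lvl n k, ‖c β‖ * ‖lamWord lam β‖ ≤
      (‖φ‖ ^ 2 - ‖c 1‖ ^ 2) / ‖φ‖ * (1 / 3) ^ k := by
  have hB := level_b ha _ hsum hmem hk
  have hS := level_sqrt hb hW hφ hk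
  calc ∑ β ∈ lvl n k, ‖c β‖ * ‖lamWord lam β‖
      = (∑ β ∈ lvl n k, (‖c β‖ / Real.sqrt (bCoeff a β)) *
          (Real.sqrt (bCoeff a β) * ‖lamWord (fun i => 3 * lam i) β‖)) * (1 / 3) ^ k := by
        rw [Finset.sum_mul]
        refine Finset.sum_congr rfl (fun β hβ => ?_)
        rw [lamWord_three, mem_lvl.1 hβ]
        have := (Real.sqrt_pos.2 (hb β)).ne'
        field_simp
        simp
    _ ≤ (Real.sqrt (∑ β ∈ lvl n k, ‖c β‖ ^ 2 / bCoeff a β) * 1) * (1 / 3) ^ k := by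
        refine mul_le_mul_of_nonneg_right ?_ (by positivity)
        refine (Real.sum_mul_le_sqrt_mul_sqrt _ _ _).trans ?_
        have e1 : ∀ β, (‖c β‖ / Real.sqrt (bCoeff a β)) ^ 2 = ‖c β‖ ^ 2 / bCoeff a β := by
          intro β
          rw [div_pow, Real.sq_sqrt (hb β).le]
        have e2 : ∀ β, (Real.sqrt (bCoeff a β) * ‖lamWord (fun i => 3 * lam i) β‖) ^ 2
            = bCoeff a β * ‖lamWord (fun i => 3 * lam i) β‖ ^ 2 := by
          intro β
          rw [mul_pow, Real.sq_sqrt (hb β).le]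
        simp only [e1, e2]
        refine mul_le_mul_of_nonneg_left ?_ (Real.sqrt_nonneg _)
        exact Real.sqrt_le_one.2 hB
    _ ≤ _ := by
        rw [mul_one]
        exact mul_le_mul_of_nonneg_right hS (by positivity)

lemma finset_sum (hb : ∀ α, 0 < bCoeff a α) (ha : ∀ α, 0 ≤ a α) (hW : IsWeightedShift a W)
    (hφ : ∀ γ : Word n,
      HasSum (fun β : Word n => c β • opWord W β (fockBasis γ)) (φ (fockBasis γ)))
    (lam : Fin n → ℂ)
    (hsum : Summable (fun α : {γ : Word n // γ ≠ 1} =>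
      a α.1 * ‖lamWord (fun i => 3 * lam i) α.1‖ ^ 2))
    (hmem : (∑' α : {γ : Word n // γ ≠ 1},
      a α.1 * ‖lamWord (fun i => 3 * lam i) α.1‖ ^ 2) ≤ 1) (s : Finset (Word n)) :
    ∑ β ∈ s, ‖c β‖ * ‖lamWord lam β‖ ≤
      ‖c 1‖ + (‖φ‖ ^ 2 - ‖c 1‖ ^ 2) / ‖φ‖ * (1 / 2) := by
  have hc := c1_le hb hW hφ
  have hE : 0 ≤ (‖φ‖ ^ 2 - ‖c 1‖ ^ 2) / ‖φ‖ :=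
    div_nonneg (by nlinarith [norm_nonneg (c 1)]) (norm_nonneg _)
  have hnn : ∀ β, 0 ≤ ‖c β‖ * ‖lamWord lam β‖ := fun β => by positivity
  have key : ∀ K : ℕ, ∑ k ∈ Finset.range (K + 1), ∑ β ∈ lvl n k, ‖c β‖ * ‖lamWord lam β‖ ≤
      ‖c 1‖ + (‖φ‖ ^ 2 - ‖c 1‖ ^ 2) / ‖φ‖ * (1 / 2 - 1 / 2 * (1 / 3) ^ K) := by
    intro K
    induction K with
    | zero =>
      have : lvl n 0 = {1} := by
        ext w
        rw [mem_lvl, wordLen_eq_zero, Finset.mem_singleton]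
      simp [this, lamWord_one]
    | succ K ih =>
      rw [Finset.sum_range_succ]
      have := level_sum hb ha hW hφ lam hsum hmem (Nat.succ_ne_zero K)
      rw [Nat.succ_eq_add_one] at this
      have e : (‖φ‖ ^ 2 - ‖c 1‖ ^ 2) / ‖φ‖ * (1 / 2 - 1 / 2 * (1 / 3) ^ (K + 1)) =
        (‖φ‖ ^ 2 - ‖c 1‖ ^ 2) / ‖φ‖ * (1 / 2 - 1 / 2 * (1 / 3) ^ K) +
        (‖φ‖ ^ 2 - ‖c 1‖ ^ 2) / ‖φ‖ * (1 / 3) ^ (K + 1) := by ring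
      rw [e]
      linarith
  have hmaps : ∀ β ∈ s, wordLen β ∈ Finset.range (s.sup wordLen + 1) := by
    intro β hβ
    rw [Finset.mem_range, Nat.lt_succ_iff]
    exact Finset.le_sup hβ
  rw [← Finset.sum_fiberwise_of_maps_to hmaps]
  refine (Finset.sum_le_sum (fun k _ => ?_)).trans ((key (s.sup wordLen)).trans ?_)
  · refine Finset.sum_le_sum_of_subset_of_nonneg ?_ (fun β _ _ => hnn β)
    intro β hβ
    exact mem_lvl.2 (Finset.mem_filter.1 hβ).2
  · have : (0 : ℝ) ≤ 1 / 2 * (1 / 3) ^ (s.sup wordLen) := by positivity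
    have := mul_le_mul_of_nonneg_left (show (1 / 2 - 1 / 2 * (1 / 3) ^ (s.sup wordLen) : ℝ) ≤ 1 / 2
      by linarith) hE
    linarith

lemma scalar_of_eq (hb : ∀ α, 0 < bCoeff a α) (hW : IsWeightedShift a W)
    (hφ : ∀ γ : Word n,
      HasSum (fun β : Word n => c β • opWord W β (fockBasis γ)) (φ (fockBasis γ)))
    (h : ‖c 1‖ = ‖φ‖) : φ = c 1 • (1 : Fock n →L[ℂ] Fock n) := by
  have hz : ∀ β, β ≠ 1 → c β = 0 := by
    intro β hβ
    have hk : wordLen β ≠ 0 := fun h => hβ (wordLen_eq_zero.1 h)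
    have h1 := level_sqrt hb hW hφ hk
    rw [h, sub_self, zero_div, Real.sqrt_le_iff] at h1
    have hnn : ∀ β ∈ lvl n (wordLen β), 0 ≤ ‖c β‖ ^ 2 / bCoeff a β :=
      fun β _ => div_nonneg (by positivity) (hb β).le
    have h2 := Finset.single_le_sum (f := fun β => ‖c β‖ ^ 2 / bCoeff a β)
      (fun β _ => div_nonneg (by positivity) (hb β).le) (mem_lvl.2 (rfl : wordLen β = wordLen β))
    have h3 : ‖c β‖ ^ 2 / bCoeff a β ≤ 0 := by
      refine h2.trans (h1.2.trans (by norm_num))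
    rw [div_le_iff₀ (hb β), zero_mul] at h3
    have : ‖c β‖ = 0 := by nlinarith [norm_nonneg (c β)]
    exact norm_eq_zero.1 this
  have hbasis : ∀ γ, φ (fockBasis γ) = c 1 • (fockBasis γ : Fock n) := by
    intro γ
    refine (hφ γ).unique ?_
    convert hasSum_single (1 : Word n) ?_ using 1
    · simp [opWord]
    · intro β hβ
      simp [hz β hβ]
  ext1 x
  have hx := lp.hasSum_single (p := 2) (by norm_num) x
  have h1 := hx.mapL φ
  have h2 := hx.mapL (c 1 • (1 : Fock n →L[ℂ] Fock n))
  refine h1.unique ?_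
  convert h2 using 2 with β
  have e : lp.single 2 β (x β) = x β • (fockBasis β : Fock n) := by
    rw [fockBasis, ← lp.single_smul]
    simp
  rw [e, map_smul, map_smul, hbasis]
  simp

end

/-- Bohr-type inequality: if `φ = Σ_β c_β W_β ∈ F_n^∞(D_f)` and
`λ ∈ ℂ^n` satisfies `(3λ_1, …, 3λ_n) ∈ D_f(ℂ)`, i.e. `Σ_{|α|≥1} a_α 9^{|α|}|λ_α|² ≤ 1`,
then `Σ_β |c_β||λ_β| ≤ ‖φ‖`; the inequality is strict unless `φ` is a scalar multiple of
the identity. -/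
theorem bohr_type_inequality {n : ℕ} (a : Word n → ℝ) (hreg : PosRegular a)
    (W : Fin n → Fock n →L[ℂ] Fock n) (hW : IsWeightedShift a W)
    (c : Word n → ℂ) (φ : Fock n →L[ℂ] Fock n)
    (hφ : ∀ γ : Word n,
      HasSum (fun β : Word n => c β • opWord W β (fockBasis γ)) (φ (fockBasis γ)))
    (lam : Fin n → ℂ)
    (hsum : Summable (fun α : {γ : Word n // γ ≠ 1} =>
      a α.1 * ‖lamWord (fun i => 3 * lam i) α.1‖ ^ 2))
    (hmem : (∑' α : {γ : Word n // γ ≠ 1},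
      a α.1 * ‖lamWord (fun i => 3 * lam i) α.1‖ ^ 2) ≤ 1) :
    Summable (fun β : Word n => ‖c β‖ * ‖lamWord lam β‖) ∧
    (∑' β : Word n, ‖c β‖ * ‖lamWord lam β‖) ≤ ‖φ‖ ∧
    ((¬ ∃ μ : ℂ, φ = μ • (1 : Fock n →L[ℂ] Fock n)) →
      (∑' β : Word n, ‖c β‖ * ‖lamWord lam β‖) < ‖φ‖) := by
  obtain ⟨-, ha, ha1, -⟩ := hreg
  have hb := bCoeff_pos ha ha1
  have hF := finset_sum hb ha hW hφ lam hsum hmem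
  have hc := c1_le hb hW hφ
  have hnn : ∀ β, 0 ≤ ‖c β‖ * ‖lamWord lam β‖ := fun β => by positivity
  have hT : (∑' β : Word n, ‖c β‖ * ‖lamWord lam β‖) ≤
      ‖c 1‖ + (‖φ‖ ^ 2 - ‖c 1‖ ^ 2) / ‖φ‖ * (1 / 2) := Real.tsum_le_of_sum_le hnn hF
  have hlt : ‖c 1‖ < ‖φ‖ → (∑' β : Word n, ‖c β‖ * ‖lamWord lam β‖) < ‖φ‖ := by
    intro h
    refine hT.trans_lt ?_
    have hM : 0 < ‖φ‖ := lt_of_le_of_lt (norm_nonneg _) h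
    have : (‖φ‖ ^ 2 - ‖c 1‖ ^ 2) / ‖φ‖ < 2 * (‖φ‖ - ‖c 1‖) := by
      rw [div_lt_iff₀ hM]
      nlinarith [mul_pos (sub_pos.2 h) (sub_pos.2 h)]
    linarith
  refine ⟨summable_of_sum_le hnn hF, ?_, ?_⟩
  · rcases hc.eq_or_lt with h | h
    · refine hT.trans ?_
      rw [h]
      simp
    · exact (hlt h).le
  · intro hns
    rcases hc.eq_or_lt with h | h
    · exact absurd ⟨c 1, scalar_of_eq hb hW hφ h⟩ hns
    · exact hlt h

end NCDomain
end

section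
/- The kernel K_f : D_f°(ℂ) × D_f°(ℂ) → ℂ defined by K_f(μ,λ) = 1/(1 − Σ_{|α|≥1} a_α μ_α λ̄_α) is positive definite, i.e., for any finitely many points λ^{(1)},…,λ^{(k)} ∈ D_f°(ℂ) and complex scalars c_1,…,c_k, Σ_{i,j} c_i c̄_j K_f(λ^{(i)}, λ^{(j)}) ≥ 0. -/
open Filter Topology
open scoped ComplexConjugate ENNReal

namespace NCDomain

open scoped ComplexOrder in
/-- Schur-type step: multiplying a positive kernel by the Gram kernel keeps it positive. -/
theorem schur_step {ι : Type*} {k : ℕ} (w : ι → ℝ) (hw : ∀ α, 0 ≤ w α) (x : Fin k → ι → ℂ)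
    (hs : ∀ i j, Summable fun α => (w α : ℂ) * x i α * conj (x j α))
    (M : Fin k → Fin k → ℂ)
    (hM : ∀ c : Fin k → ℂ, 0 ≤ ∑ i, ∑ j, c i * conj (c j) * M i j) (c : Fin k → ℂ) :
    0 ≤ ∑ i, ∑ j, c i * conj (c j) *
      (M i j * ∑' α, (w α : ℂ) * x i α * conj (x j α)) := by
  have h : HasSum (fun α => ∑ i, ∑ j, c i * conj (c j) *
      (M i j * ((w α : ℂ) * x i α * conj (x j α))))
      (∑ i, ∑ j, c i * conj (c j) * (M i j * ∑' α, (w α : ℂ) * x i α * conj (x j α))) :=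
    hasSum_sum fun i _ => hasSum_sum fun j _ =>
      ((hs i j).hasSum.mul_left (M i j)).mul_left (c i * conj (c j))
  refine h.nonneg fun α => ?_
  have h1 := hM (fun i => c i * x i α)
  have h2 : (0 : ℂ) ≤ (w α : ℂ) := by exact_mod_cast hw α
  have h3 := mul_nonneg h2 h1
  refine h3.trans_eq ?_
  simp only [Finset.mul_sum, map_mul]
  refine Finset.sum_congr rfl fun i _ => Finset.sum_congr rfl fun j _ => ?_
  ring

theorem gram_term_bound (w : ℝ) (hw : 0 ≤ w) (x y : ℂ) :
    ‖(w : ℂ) * x * conj y‖ ≤ (w * ‖x‖ ^ 2 + w * ‖y‖ ^ 2) / 2 := by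
  rw [norm_mul, norm_mul, RCLike.norm_conj, Complex.norm_real, Real.norm_of_nonneg hw]
  nlinarith [mul_nonneg hw (sq_nonneg (‖x‖ - ‖y‖))]

open scoped ComplexOrder in
theorem kernel_aux {ι : Type*} {k : ℕ} (w : ι → ℝ) (hw : ∀ α, 0 ≤ w α) (x : Fin k → ι → ℂ)
    (hsum : ∀ j, Summable fun α => w α * ‖x j α‖ ^ 2)
    (hmem : ∀ j, ∑' α, w α * ‖x j α‖ ^ 2 < 1) (c : Fin k → ℂ) :
    0 ≤ ∑ i, ∑ j, c i * conj (c j) *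
      (1 - ∑' α, (w α : ℂ) * x i α * conj (x j α))⁻¹ := by
  have hb : ∀ i j, Summable fun α => (w α * ‖x i α‖ ^ 2 + w α * ‖x j α‖ ^ 2) / 2 :=
    fun i j => ((hsum i).add (hsum j)).div_const 2
  have hs : ∀ i j, Summable fun α => (w α : ℂ) * x i α * conj (x j α) := fun i j =>
    Summable.of_norm_bounded (hb i j) fun α => gram_term_bound _ (hw α) _ _
  have hn : ∀ i j, ‖∑' α, (w α : ℂ) * x i α * conj (x j α)‖ < 1 := by
    intro i j
    have h1 := tsum_of_norm_bounded (hb i j).hasSum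
      fun α => gram_term_bound _ (hw α) (x i α) (x j α)
    rw [tsum_div_const, (hsum i).tsum_add (hsum j)] at h1
    linarith [hmem i, hmem j]
  have hp : ∀ m : ℕ, ∀ c : Fin k → ℂ, 0 ≤ ∑ i, ∑ j, c i * conj (c j) *
      (∑' α, (w α : ℂ) * x i α * conj (x j α)) ^ m := by
    intro m
    induction m with
    | zero =>
      intro c
      have : ∑ i, ∑ j, c i * conj (c j) *
          (∑' α, (w α : ℂ) * x i α * conj (x j α)) ^ 0 = (∑ i, c i) * star (∑ i, c i) := by
        simp [Finset.sum_mul_sum]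
      rw [this]
      exact mul_star_self_nonneg _
    | succ m ih =>
      intro c
      simp only [pow_succ]
      exact schur_step w hw x hs _ ih c
  have h : HasSum (fun m : ℕ => ∑ i, ∑ j, c i * conj (c j) *
      (∑' α, (w α : ℂ) * x i α * conj (x j α)) ^ m)
      (∑ i, ∑ j, c i * conj (c j) * (1 - ∑' α, (w α : ℂ) * x i α * conj (x j α))⁻¹) :=
    hasSum_sum fun i _ => hasSum_sum fun j _ =>
      (hasSum_geometric_of_norm_lt_one (hn i j)).mul_left (c i * conj (c j))
  exact h.nonneg fun m => hp m c

/-- the kernel `K_f(μ,λ) = 1/(1 − Σ_{|α|≥1} a_α μ_α λ̄_α)` is positive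
definite on `D_f°(ℂ)`: for points `λ^{(1)}, …, λ^{(k)} ∈ D_f°(ℂ)` and scalars
`c_1, …, c_k ∈ ℂ`, the quantity `Σ_{i,j} c_i c̄_j K_f(λ^{(i)}, λ^{(j)})` is a nonnegative
real number. -/
theorem kernel_positive_definite {n : ℕ} (a : Word n → ℝ) (hreg : PosRegular a)
    (k : ℕ) (lam : Fin k → Fin n → ℂ)
    (hsum : ∀ j : Fin k,
      Summable (fun α : {γ : Word n // γ ≠ 1} => a α.1 * ‖lamWord (lam j) α.1‖ ^ 2))
    (hmem : ∀ j : Fin k,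
      (∑' α : {γ : Word n // γ ≠ 1}, a α.1 * ‖lamWord (lam j) α.1‖ ^ 2) < 1)
    (c : Fin k → ℂ) :
    0 ≤ (∑ i : Fin k, ∑ j : Fin k, c i * conj (c j) *
        (1 - ∑' α : {γ : Word n // γ ≠ 1},
          (a α.1 : ℂ) * lamWord (lam i) α.1 * conj (lamWord (lam j) α.1))⁻¹).re ∧
      (∑ i : Fin k, ∑ j : Fin k, c i * conj (c j) *
        (1 - ∑' α : {γ : Word n // γ ≠ 1},
          (a α.1 : ℂ) * lamWord (lam i) α.1 * conj (lamWord (lam j) α.1))⁻¹).im = 0 := by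
  have h := kernel_aux (fun α : {γ : Word n // γ ≠ 1} => a α.1) (fun α => hreg.2.1 α.1)
    (fun j α => lamWord (lam j) α.1) hsum hmem c
  rw [Complex.le_def] at h
  exact ⟨h.1, h.2.symm⟩

end NCDomain
end
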